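/- Let n ≥ 1 and 0 < y₁ ≤ … ≤ yₙ with yₙ > 0. Define vᵢ = sin²((1/2)·arcsin√(yᵢ/yₙ)), S₂ = Σᵢ vᵢ², S₃ = Σᵢ vᵢ³, and assume S₂ > 0, S₃ > 0, S₂ > S₃. Suppose μ, α, β, p > 0 satisfy the four relations: (i) 3μα²p = β + 3μα; (ii) 3μα²p² = 4βyₙ (vanishing discriminant for the largest component); (iii) α·p·S₃ = S₂ (i.e., α equals the norm ratio Σxᵢ²/Σxᵢ³ of the vector xᵢ = p·vᵢ); and (iv) β = p·√S₂ (i.e., β = ‖x‖₂). Then μ = 16·S₃²·(S₂ − S₃)·yₙ²/(3·S₂^{5/2}). -/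

import Mathlib

/-- Closed-form critical parameter for the inverse-skewness
proximity operator: with `vᵢ = sin²((1/2)arcsin√(yᵢ/yₙ))`, `S₂ = Σvᵢ²`,
`S₃ = Σvᵢ³`, if `μ, α, β, p > 0` satisfy `3μα²p = β + 3μα`,
`3μα²p² = 4βyₙ`, `αpS₃ = S₂` and `β = p√S₂`, then
`μ = 16S₃²(S₂ − S₃)yₙ²/(3S₂^{5/2})`. -/
theorem critical_mu_inverse_skewness
    (n : ℕ) (y : Fin (n + 1) → ℝ) (hy0 : ∀ i, 0 < y i) (hymono : Monotone y)
    (v : Fin (n + 1) → ℝ)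
    (hv : ∀ i, v i =
      Real.sin ((1 / 2) * Real.arcsin (Real.sqrt (y i / y (Fin.last n)))) ^ 2)
    (S₂ S₃ : ℝ) (hS2 : S₂ = ∑ i, (v i) ^ 2) (hS3 : S₃ = ∑ i, (v i) ^ 3)
    (hS2pos : 0 < S₂) (hS3pos : 0 < S₃) (hS23 : S₃ < S₂)
    (μ α β p : ℝ) (hμ : 0 < μ) (hα : 0 < α) (hβ : 0 < β) (hp : 0 < p)
    (h1 : 3 * μ * α ^ 2 * p = β + 3 * μ * α)
    (h2 : 3 * μ * α ^ 2 * p ^ 2 = 4 * β * y (Fin.last n))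
    (h3 : α * p * S₃ = S₂)
    (h4 : β = p * Real.sqrt S₂) :
    μ = 16 * S₃ ^ 2 * (S₂ - S₃) * (y (Fin.last n)) ^ 2
          / (3 * S₂ ^ ((5 : ℝ) / 2)) := by
  set Y := y (Fin.last n)
  set s := Real.sqrt S₂
  have hs : 0 < s := Real.sqrt_pos.2 hS2pos
  have hss : S₂ = s ^ 2 := (Real.sq_sqrt hS2pos.le).symm
  have hpow : S₂ ^ ((5 : ℝ) / 2) = s ^ 5 := by
    rw [hss, ← Real.rpow_natCast s 2, ← Real.rpow_natCast s 5, ← Real.rpow_mul hs.le]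
    norm_num
  obtain ⟨c, hc⟩ : ∃ c, c = α * p := ⟨_, rfl⟩
  have hcpos : 0 < c := hc ▸ mul_pos hα hp
  have hcS : c * S₃ = s ^ 2 := by rw [hc, h3, hss]
  have hdisc : 3 * μ * c ^ 2 = 4 * (p * s) * Y := by rw [hc, ← h4, ← h2]; ring
  have hsum : 3 * μ * c * (c - 1) = p ^ 2 * s := by
    rw [hc]
    linear_combination p * h1 + p * h4
  have hcube : 3 * μ * c ^ 3 = 16 * s * Y ^ 2 * (c - 1) := by
    apply mul_left_cancel₀ (mul_pos (mul_pos three_pos hμ) hcpos).ne'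
    linear_combination (3 * μ * c ^ 2 + 4 * (p * s) * Y) * hdisc - 16 * s * Y ^ 2 * hsum
  rw [hpow, eq_div_iff (by positivity), hss, ← hcS]
  apply mul_left_cancel₀ hs.ne'
  calc s * (μ * (3 * s ^ 5)) = μ * (3 * (s ^ 2) ^ 3) := by ring
    _ = 3 * μ * c ^ 3 * S₃ ^ 3 := by rw [← hcS]; ring
    _ = s * (16 * S₃ ^ 2 * (c * S₃ - S₃) * Y ^ 2) := by rw [hcube]; ring
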